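/- arXiv:1807.11523 — 3 statements merged into one kernel-verified Lean document; each statement's English description precedes it below -/
import Mathlib

section
/- Let H be a locally finitely generated monoid with inf R̄(H) = 1. Then H is fully elastic: for every rational number q with 1 < q < ρ(H) there exists a ∈ H such that ρ(a) = q. -/
open Filter Topology

/-- The set of factorization lengths of `a`: the set of all `k` such that `a` is a
product of `k` atoms (irreducibles); by convention it is `{0}` for units. -/
noncomputable def lengthSet (H : Type*) [CommMonoid H] (a : H) : Set ℕ :=
  open Classical in
  if IsUnit a then {0}
  else {k | ∃ f : Fin k → H, (∀ i, Irreducible (f i)) ∧ a = ∏ i, f i}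

/-- The elasticity `ρ(a) = max L(a) / min L(a)` of an element of a BF-monoid,
with `ρ(a) = 1` for units. -/
noncomputable def elasticity (H : Type*) [CommMonoid H] (a : H) : ℝ :=
  open Classical in
  if IsUnit a then 1
  else ((sSup (lengthSet H a) : ℕ) : ℝ) / ((sInf (lengthSet H a) : ℕ) : ℝ)

/-- The elasticity `ρ(H) = sup {ρ(a) : a ∈ H} ∈ ℝ≥1 ∪ {∞}` of the monoid `H`. -/
noncomputable def monoidElasticity (H : Type*) [CommMonoid H] : EReal :=
  ⨆ a : H, ((elasticity H a : ℝ) : EReal)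

/-- The set `R̄(H)` of asymptotic elasticities `ρ̄(a) = lim_{n → ∞} ρ(aⁿ)`
of nonunits `a ∈ H` (membership requires the limit to exist). -/
def asympSet (H : Type*) [CommMonoid H] : Set EReal :=
  {r | ∃ a : H, ¬ IsUnit a ∧
    Tendsto (fun n : ℕ => ((elasticity H (a ^ n) : ℝ) : EReal)) atTop (nhds r)}

/-- `H` is locally finitely generated: for every `a ∈ H` there are only finitely many
atoms, up to associates, dividing some power of `a`. -/
def LocallyFinitelyGenerated (H : Type*) [CommMonoid H] : Prop :=
  ∀ a : H, {u : Associates H | Irreducible u ∧ ∃ n : ℕ, u ∣ Associates.mk (a ^ n)}.Finite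

/-- `H` is a BF-monoid: atomic (every nonunit has a factorization into atoms) and
all sets of lengths are finite. -/
def IsBFMonoid (H : Type*) [CommMonoid H] : Prop :=
  (∀ a : H, ¬ IsUnit a → (lengthSet H a).Nonempty) ∧ ∀ a : H, (lengthSet H a).Finite

/-- `(k, ℓ) ≠ (0,0)` is a nice pair with respect to `(a, b)` if
`max L((aᵏbˡ)ᵗ) = t · max L(aᵏbˡ)` and `min L((aᵏbˡ)ᵗ) = t · min L(aᵏbˡ)` for all `t ∈ ℕ`. -/
def IsNicePair (H : Type*) [CommMonoid H] (a b : H) (k ℓ : ℕ) : Prop :=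
  ¬ (k = 0 ∧ ℓ = 0) ∧ ∀ t : ℕ, 0 < t →
    sSup (lengthSet H ((a ^ k * b ^ ℓ) ^ t)) = t * sSup (lengthSet H (a ^ k * b ^ ℓ)) ∧
    sInf (lengthSet H ((a ^ k * b ^ ℓ) ^ t)) = t * sInf (lengthSet H (a ^ k * b ^ ℓ))

/-- `H` is strongly primary: `H ≠ H^×` and for every nonunit `a` there is `n ∈ ℕ`
such that every product of `n` nonunits of `H` is divisible by `a`. -/
def StronglyPrimary (H : Type*) [CommMonoid H] : Prop :=
  (∃ a : H, ¬ IsUnit a) ∧ ∀ a : H, ¬ IsUnit a → ∃ n : ℕ, 0 < n ∧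
    ∀ f : Fin n → H, (∀ i, ¬ IsUnit (f i)) → a ∣ ∏ i, f i

/-- `H` is half-factorial: atomic and `|L(a)| = 1` for every `a ∈ H`. -/
def IsHalfFactorial (H : Type*) [CommMonoid H] : Prop :=
  ∀ a : H, ∃ k : ℕ, lengthSet H a = {k}


/-- Dickson's lemma, in the following form: a subset closed under differences has finitely many
elements detecting positivity of every additive functional. -/
lemma exists_finset_le_and_pos {α : Type*} [AddCommMonoid α] [PartialOrder α]
    [CanonicallyOrderedAdd α] [IsOrderedCancelAddMonoid α] [WellQuasiOrderedLE α] (Z : Set α)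
    (hZ : ∀ g w, g ∈ Z → g + w ∈ Z → w ∈ Z) :
    ∃ G : Finset α, (∀ g ∈ G, g ∈ Z ∧ g ≠ 0) ∧
      ∀ z ∈ Z, ∀ f : α →+ ℤ, 0 < f z → ∃ g ∈ G, g ≤ z ∧ 0 < f g := by
  have hfin : {x | Minimal (fun x => x ∈ Z ∧ x ≠ 0) x}.Finite :=
    WellQuasiOrderedLE.finite_of_isAntichain (setOfPred_minimal_antichain _)
  refine ⟨hfin.toFinset, fun g hg => ?_, fun z => ?_⟩
  · rw [Set.Finite.mem_toFinset, Set.mem_ofPred_eq] at hg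
    exact hg.prop
  induction z using WellFoundedLT.induction with
  | ind z ih =>
    intro hz f hf
    have hz0 : z ≠ 0 := by
      rintro rfl
      simp at hf
    obtain ⟨g, hgz, hg⟩ := exists_minimal_le_of_wellFoundedLT (fun x => x ∈ Z ∧ x ≠ 0) z ⟨hz, hz0⟩
    obtain ⟨w, rfl⟩ := exists_add_of_le hgz
    by_cases hfg : 0 < f g
    · exact ⟨g, by simpa using hg, hgz, hfg⟩
    · have hw : w < g + w := lt_add_of_pos_left w (pos_iff_ne_zero.2 hg.prop.2)
      obtain ⟨g', hg', hle, hpos⟩ := ih w hw (hZ g w hg.prop.1 hz) f (by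
        rw [map_add] at hf
        omega)
      exact ⟨g', hg', hle.trans hw.le, hpos⟩

/-- A rational intermediate value principle: if `ψ` is negative on the ray `l = 0` and positive on
the ray `k = 0`, then it vanishes over some rational ray of the quadrant. -/
lemma exists_mem_eq_zero {α : Type*} [AddCommMonoid α] [PartialOrder α]
    [CanonicallyOrderedAdd α] [IsOrderedCancelAddMonoid α] [WellQuasiOrderedLE α] (T : Set α)
    (hsub : ∀ g w, g ∈ T → g + w ∈ T → w ∈ T)
    (hcomb : ∀ g h t, g ∈ T → h ∈ T → t ∈ T → g ≤ t → h ≤ t → ∀ p q : ℕ, p • g + q • h ∈ T)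
    (k l : α →+ ℕ) (ψ : α →+ ℤ)
    (hpos : ∀ t ∈ T, t ≠ 0 → 0 < k t + l t)
    (hdir : ∀ k₀ l₀ : ℕ, 0 < k₀ + l₀ → ∃ N > 0, ∃ t ∈ T, k t = N * k₀ ∧ l t = N * l₀)
    (huniq : ∀ t ∈ T, ∀ t' ∈ T, k t = k t' → l t = l t' → ψ t = ψ t')
    (hneg : ∀ t ∈ T, l t = 0 → 0 < k t → ψ t < 0)
    (hposit : ∀ t ∈ T, k t = 0 → 0 < l t → 0 < ψ t) :
    ∃ t ∈ T, 0 < k t + l t ∧ ψ t = 0 := by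
  by_contra! hne
  have hsmul : ∀ t ∈ T, ∀ p : ℕ, p • t ∈ T := fun t ht p => by
    simpa using hcomb t t t ht ht ht le_rfl le_rfl p 0
  obtain ⟨G, hG, hGen⟩ := exists_finset_le_and_pos T hsub
  have hGne : ∀ g ∈ G, ψ g ≠ 0 := fun g hg => hne g (hG g hg).1 (hpos g (hG g hg).1 (hG g hg).2)
  obtain ⟨s, hs, hmin⟩ : ∃ s ∈ G.filter (fun g => 0 < ψ g), ∀ g ∈ G.filter (fun g => 0 < ψ g),
      (l s : ℚ) / (k s + l s) ≤ (l g : ℚ) / (k g + l g) := by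
    apply Finset.exists_min_image
    obtain ⟨N, hN, t, ht, htk, htl⟩ := hdir 0 1 (by norm_num)
    obtain ⟨g, hg, -, hgpos⟩ := hGen t ht ψ (hposit t ht (by simpa using htk) (by omega))
    exact ⟨g, by simp [hg, hgpos]⟩
  obtain ⟨hsG, hsψ⟩ := Finset.mem_filter.1 hs
  have hsT := (hG s hsG).1
  have hspos := hpos s hsT (hG s hsG).2
  have hslope : ∀ g ∈ G, 0 < ψ g → l s * k g ≤ l g * k s := by
    intro g hg hgψ
    have h := hmin g (Finset.mem_filter.2 ⟨hg, hgψ⟩)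
    have hgpos := hpos g (hG g hg).1 (hG g hg).2
    rw [div_le_div_iff₀ (by exact_mod_cast hspos) (by exact_mod_cast hgpos)] at h
    have h' : l s * (k g + l g) ≤ l g * (k s + l s) := by exact_mod_cast h
    nlinarith
  have hls : 0 < l s := by
    by_contra h0
    have := hneg s hsT (by omega) (by omega)
    omega
  let kz : α →+ ℤ := (Nat.castAddMonoidHom ℤ).comp k
  let lz : α →+ ℤ := (Nat.castAddMonoidHom ℤ).comp l
  let c : α →+ ℤ := (k s) • lz - (l s) • kz
  have hc : ∀ t, c t = (k s : ℤ) * l t - l s * k t := fun t => by simp [c, kz, lz]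
  let K : ℕ := ∑ g ∈ G, (k g + l g)
  have hK : ∀ g ∈ G, k g + l g ≤ K := fun g hg =>
    Finset.single_le_sum (f := fun g => k g + l g) (fun _ _ => Nat.zero_le _) hg
  let f : α →+ ℤ := K • c + kz + lz
  have hf : ∀ t, f t = K * c t + k t + l t := fun t => by simp [f, kz, lz]
  obtain ⟨N, hN, t, ht, htk, htl⟩ := hdir (K * k s + 1) (K * l s) (by omega)
  have hct : c t = -(N * l s) := by
    rw [hc, htk, htl]
    push_cast
    ring
  have hNl : (0 : ℤ) < N * l s := by positivity
  obtain ⟨h, hh, hht, hch⟩ := hGen t ht (-c) (by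
    rw [AddMonoidHom.neg_apply, hct]
    omega)
  rw [AddMonoidHom.neg_apply] at hch
  obtain ⟨g, hg, hgt, hfg⟩ := hGen t ht f (by
    rw [hf, hct, htk, htl]
    push_cast
    have : (0 : ℤ) < N * (K * k s + 1) := by positivity
    linarith)
  have hcg : 0 ≤ c g := by
    by_contra! hlt
    rw [hf] at hfg
    have h1 : ((k g + l g : ℕ) : ℤ) ≤ K := by exact_mod_cast hK g hg
    push_cast at h1
    have h2 : (K : ℤ) * c g ≤ K * (-1) :=
      mul_le_mul_of_nonneg_left (by omega) (by positivity)
    linarith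
  have hhψ : ψ h < 0 := by
    by_contra! hle
    have h1 := hslope h hh (lt_of_le_of_ne hle (hGne h hh).symm)
    have h2 : (l s : ℤ) * k h ≤ l h * k s := by exact_mod_cast h1
    rw [hc] at hch
    linarith
  have hgpos := hpos g (hG g hg).1 (hG g hg).2
  have hgψ : ψ g < 0 := by
    by_contra! hle
    obtain ⟨p, hp⟩ := Int.eq_ofNat_of_zero_le (a := -ψ h) (by omega)
    obtain ⟨r, hr⟩ := Int.eq_ofNat_of_zero_le hle
    refine hne _ (hcomb g h t (hG g hg).1 (hG h hh).1 ht hgt hht p r) ?_ ?_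
    · have : 0 < p := by omega
      have : 0 < p * (k g + l g) := by positivity
      simp only [map_add, map_nsmul, smul_eq_mul]
      linarith [Nat.zero_le (r * k h), Nat.zero_le (r * l h)]
    · simp only [map_add, map_nsmul, nsmul_eq_mul, hr, ← hp]
      have : ψ h = -p := by omega
      rw [this]
      ring
  obtain ⟨p, hp⟩ := Int.eq_ofNat_of_zero_le hch.le
  obtain ⟨r, hr⟩ := Int.eq_ofNat_of_zero_le hcg
  have hp0 : 0 < p := by omega
  have hvT := hcomb g h t (hG g hg).1 (hG h hh).1 ht hgt hht p r
  set v := p • g + r • h with hv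
  have hcv : c v = 0 := by
    have : c h = -p := by omega
    simp only [hv, map_add, map_nsmul, nsmul_eq_mul, hr, this]
    ring
  have hψv : ψ v < 0 := by
    simp only [hv, map_add, map_nsmul, nsmul_eq_mul]
    have h1 : (p : ℤ) * ψ g < 0 := mul_neg_of_pos_of_neg (by exact_mod_cast hp0) hgψ
    have h2 : (r : ℤ) * ψ h ≤ 0 := mul_nonpos_of_nonneg_of_nonpos (by positivity) hhψ.le
    linarith
  have hkl : k s * l v = l s * k v := by
    have := hc v
    rw [hcv] at this
    have h' : (k s : ℤ) * l v = l s * k v := by linarith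
    exact_mod_cast h'
  have heq := huniq _ (hsmul v hvT (l s)) _ (hsmul s hsT (l v))
    (by simp only [map_nsmul, smul_eq_mul]; linarith)
    (by simp only [map_nsmul, smul_eq_mul]; ring)
  simp only [map_nsmul, nsmul_eq_mul] at heq
  have h1 : (l s : ℤ) * ψ v < 0 := mul_neg_of_pos_of_neg (by exact_mod_cast hls) hψv
  have h2 : 0 ≤ (l v : ℤ) * ψ s := by positivity
  linarith

/-- The value of `φ` at `x` cannot be improved asymptotically among elements with the same image
under `P`. -/
def IsStable {β A : Type*} [AddCommMonoid β] [CommMonoid A] (P : β → A) (φ : β →+ ℤ) (x : β) :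
    Prop :=
  ∀ (n : ℕ) (y : β), P y = P x ^ n → φ y ≤ n * φ x

section Stable

variable {β A : Type*} [AddCommMonoid β] [CommMonoid A] {P : β → A} {φ : β →+ ℤ}

lemma apply_nsmul_eq_pow (hadd : ∀ x y, P (x + y) = P x * P y) (hone : ∀ x, P x = 1 ↔ x = 0)
    (n : ℕ) (x : β) : P (n • x) = P x ^ n := by
  induction n with
  | zero => rw [zero_smul, pow_zero, hone]
  | succ n ih => rw [succ_nsmul, hadd, ih, pow_succ]

lemma IsStable.of_add (hadd : ∀ x y, P (x + y) = P x * P y) (hone : ∀ x, P x = 1 ↔ x = 0)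
    {x y : β} (h : IsStable P φ (x + y)) : IsStable P φ x := by
  intro n z hz
  have := h n (z + n • y) (by rw [hadd, hadd, hz, apply_nsmul_eq_pow hadd hone, mul_pow])
  simp only [map_add, map_nsmul, nsmul_eq_mul] at this
  linarith

lemma IsStable.nsmul (hadd : ∀ x y, P (x + y) = P x * P y) (hone : ∀ x, P x = 1 ↔ x = 0)
    {x : β} (h : IsStable P φ x) (m : ℕ) : IsStable P φ (m • x) := by
  intro n z hz
  have := h (m * n) z (by rw [hz, apply_nsmul_eq_pow hadd hone, pow_mul])
  simp only [map_nsmul, nsmul_eq_mul]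
  push_cast at this
  linarith

lemma exists_isStable [PartialOrder β] [CanonicallyOrderedAdd β] [IsOrderedCancelAddMonoid β]
    [WellQuasiOrderedLE β] [IsCancelMul A]
    (hadd : ∀ x y, P (x + y) = P x * P y) (hone : ∀ x, P x = 1 ↔ x = 0) (φ : β →+ ℤ)
    {c : A} (x₀ : β) (hx₀ : P x₀ = c) :
    ∃ N > 0, ∃ x, P x = c ^ N ∧ IsStable P φ x := by
  obtain ⟨G, hG, hGen⟩ := exists_finset_le_and_pos {z : ℕ × β | P z.2 = c ^ z.1} (by
    rintro ⟨n, x⟩ ⟨m, y⟩ h1 h2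
    simp only [Set.mem_ofPred_eq, Prod.mk_add_mk] at h1 h2 ⊢
    rw [hadd, h1, pow_add] at h2
    exact mul_left_cancel h2)
  simp only [Set.mem_ofPred_eq] at hG hGen
  have hGpos : ∀ g ∈ G, 0 < g.1 := by
    rintro ⟨n, x⟩ hg
    obtain ⟨h1, h2⟩ := hG _ hg
    rw [Nat.pos_iff_ne_zero]
    rintro rfl
    simp only [pow_zero, hone] at h1
    exact h2 (by simp [h1])
  let F : ℕ × β →+ ℤ := (Nat.castAddMonoidHom ℤ).comp (AddMonoidHom.fst ℕ β)
  obtain ⟨g, hg, hmax⟩ : ∃ g ∈ G, ∀ g' ∈ G, (φ g'.2 : ℚ) / g'.1 ≤ (φ g.2 : ℚ) / g.1 := by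
    apply Finset.exists_max_image
    obtain ⟨g, hg, -⟩ := hGen (1, x₀) (by simp [hx₀]) F (by simp [F])
    exact ⟨g, hg⟩
  have hgpos := hGpos g hg
  refine ⟨g.1, hgpos, g.2, (hG g hg).1, fun n y hy => ?_⟩
  by_contra! hlt
  let f : ℕ × β →+ ℤ := g.1 • φ.comp (AddMonoidHom.snd ℕ β) - (φ g.2) • F
  have hf : ∀ z, f z = g.1 * φ z.2 - φ g.2 * z.1 := fun z => by simp [f, F]
  obtain ⟨g', hg', -, hpos⟩ := hGen (g.1 * n, y) (by rw [hy, (hG g hg).1, pow_mul]) f (by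
    rw [hf]
    push_cast
    have : (0 : ℤ) < g.1 * (φ y - n * φ g.2) := mul_pos (by exact_mod_cast hgpos) (by linarith)
    linarith)
  have h1 := hmax g' hg'
  have hg'pos := hGpos g' hg'
  rw [div_le_div_iff₀ (by exact_mod_cast hg'pos) (by exact_mod_cast hgpos)] at h1
  have h2 : φ g'.2 * g.1 ≤ φ g.2 * g'.1 := by exact_mod_cast h1
  rw [hf] at hpos
  linarith

/-- If the ratio of maximal to minimal lengths is asymptotically below `m / n` on powers of `a`,
and above `m / n` at `b`, then it equals `m / n` at some `a ^ k * b ^ l`. -/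
lemma exists_length_ratio_eq [PartialOrder β] [CanonicallyOrderedAdd β]
    [IsOrderedCancelAddMonoid β] [WellQuasiOrderedLE β] [IsCancelMul A]
    (hadd : ∀ x y, P (x + y) = P x * P y) (hone : ∀ x, P x = 1 ↔ x = 0) (φ : β →+ ℤ)
    {a b : A} (xa : β) (hxa : P xa = a) (m n : ℕ)
    (ha : ∀ k, 0 < k → ∀ x y, P x = a ^ k → P y = a ^ k → n * φ x < m * φ y)
    (xb yb : β) (hxb : P xb = b) (hyb : P yb = b) (hb : m * φ yb < n * φ xb) :
    ∃ k l, 0 < k + l ∧ ∃ x y, P x = a ^ k * b ^ l ∧ P y = a ^ k * b ^ l ∧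
      (∀ z, P z = a ^ k * b ^ l → φ y ≤ φ z ∧ φ z ≤ φ x) ∧ n * φ x = m * φ y := by
  let S : Set (ℕ × ℕ × β × β) :=
    {t | P t.2.2.1 = a ^ t.1 * b ^ t.2.1 ∧ P t.2.2.2 = a ^ t.1 * b ^ t.2.1}
  let T : Set (ℕ × ℕ × β × β) :=
    {t | t ∈ S ∧ IsStable P φ t.2.2.1 ∧ IsStable P (-φ) t.2.2.2}
  have hT : ∀ k l x y, (k, l, x, y) ∈ T ↔ (P x = a ^ k * b ^ l ∧ P y = a ^ k * b ^ l) ∧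
      IsStable P φ x ∧ IsStable P (-φ) y := fun k l x y => Iff.rfl
  have hbd : ∀ {k l x y z}, (k, l, x, y) ∈ T → P z = a ^ k * b ^ l → φ y ≤ φ z ∧ φ z ≤ φ x := by
    rintro k l x y z ⟨⟨hx, hy⟩, hsx, hsy⟩ hz
    simp only at hx hy hsx hsy
    have h1 := hsx 1 z (by rw [hz, hx, pow_one])
    have h2 := hsy 1 z (by rw [hz, hy, pow_one])
    simp only [AddMonoidHom.neg_apply] at h2
    push_cast at h1 h2
    constructor <;> linarith
  have hdown : ∀ s ∈ S, ∀ w, s + w ∈ T → s ∈ T := by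
    rintro ⟨k, l, x, y⟩ hs ⟨k', l', x', y'⟩ ⟨-, hx, hy⟩
    exact ⟨hs, hx.of_add hadd hone, hy.of_add hadd hone⟩
  have hSadd : ∀ s ∈ S, ∀ t ∈ S, s + t ∈ S := by
    rintro ⟨k, l, x, y⟩ ⟨hx, hy⟩ ⟨k', l', x', y'⟩ ⟨hx', hy'⟩
    simp only at hx hy hx' hy'
    constructor
    · simp only [Prod.mk_add_mk]
      rw [hadd, hx, hx', pow_add, pow_add, mul_mul_mul_comm]
    · simp only [Prod.mk_add_mk]
      rw [hadd, hy, hy', pow_add, pow_add, mul_mul_mul_comm]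
  have hSsmul : ∀ s ∈ S, ∀ p : ℕ, p • s ∈ S := by
    intro s hs p
    induction p with
    | zero => simp [S, hone]
    | succ p ih =>
      rw [succ_nsmul]
      exact hSadd _ ih _ hs
  have hTsmul : ∀ t ∈ T, ∀ p : ℕ, p • t ∈ T := fun t ht p =>
    ⟨hSsmul t ht.1 p, ht.2.1.nsmul hadd hone p, ht.2.2.nsmul hadd hone p⟩
  let k : ℕ × ℕ × β × β →+ ℕ := AddMonoidHom.fst _ _
  let l : ℕ × ℕ × β × β →+ ℕ := (AddMonoidHom.fst _ _).comp (AddMonoidHom.snd _ _)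
  let X : ℕ × ℕ × β × β →+ β :=
    (AddMonoidHom.fst _ _).comp ((AddMonoidHom.snd _ _).comp (AddMonoidHom.snd _ _))
  let Y : ℕ × ℕ × β × β →+ β :=
    (AddMonoidHom.snd _ _).comp ((AddMonoidHom.snd _ _).comp (AddMonoidHom.snd _ _))
  let ψ : ℕ × ℕ × β × β →+ ℤ := n • φ.comp X - m • φ.comp Y
  have hψ : ∀ k l x y, ψ (k, l, x, y) = n * φ x - m * φ y := fun k l x y => by simp [ψ, X, Y]
  suffices h : ∃ t ∈ T, 0 < k t + l t ∧ ψ t = 0 by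
    obtain ⟨⟨k₀, l₀, x, y⟩, ht, hpos, hzero⟩ := h
    refine ⟨k₀, l₀, hpos, x, y, ht.1.1, ht.1.2, fun z hz => hbd ht hz, ?_⟩
    rw [hψ] at hzero
    linarith
  refine exists_mem_eq_zero T ?_ ?_ k l ψ ?_ ?_ ?_ ?_ ?_
  · rintro ⟨k, l, x, y⟩ ⟨k', l', x', y'⟩ ⟨⟨hx, hy⟩, -⟩ ht
    have ht' := ht
    obtain ⟨⟨h1, h2⟩, -⟩ := ht'
    rw [add_comm] at ht
    refine hdown _ ⟨?_, ?_⟩ _ ht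
    · simp only [Prod.mk_add_mk] at h1 hx ⊢
      rw [hadd, hx, pow_add, pow_add, mul_mul_mul_comm] at h1
      exact mul_left_cancel h1
    · simp only [Prod.mk_add_mk] at h2 hy ⊢
      rw [hadd, hy, pow_add, pow_add, mul_mul_mul_comm] at h2
      exact mul_left_cancel h2
  · intro g h t hg hh ht hgt hht p q
    obtain ⟨w, rfl⟩ := exists_add_of_le hgt
    obtain ⟨w', hw'⟩ := exists_add_of_le hht
    refine hdown _ (hSadd _ (hSsmul g hg.1 p) _ (hSsmul h hh.1 q)) (p • w + q • w') ?_
    have : p • g + q • h + (p • w + q • w') = (p + q) • (g + w) := by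
      rw [add_smul]
      nth_rewrite 2 [hw']
      rw [smul_add, smul_add, add_add_add_comm]
    rw [this]
    exact hTsmul _ ht _
  · rintro ⟨k', l', x, y⟩ ⟨⟨hx, hy⟩, -⟩ ht0
    rw [Nat.pos_iff_ne_zero]
    intro h0
    have hk : k' = 0 := by
      change k' + l' = 0 at h0
      omega
    have hl : l' = 0 := by
      change k' + l' = 0 at h0
      omega
    subst hk hl
    simp only [pow_zero, mul_one, hone] at hx hy
    exact ht0 (by simp [hx, hy])
  · intro k₀ l₀ h0
    have hz : P (k₀ • xa + l₀ • xb) = a ^ k₀ * b ^ l₀ := by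
      rw [hadd, apply_nsmul_eq_pow hadd hone, apply_nsmul_eq_pow hadd hone, hxa, hxb]
    obtain ⟨N, hN, x, hx, hsx⟩ := exists_isStable hadd hone φ _ hz
    obtain ⟨M, hM, y, hy, hsy⟩ := exists_isStable hadd hone (-φ) _ hz
    refine ⟨N * M, Nat.mul_pos hN hM, (N * M * k₀, N * M * l₀, M • x, N • y),
      ⟨⟨?_, ?_⟩, hsx.nsmul hadd hone M, hsy.nsmul hadd hone N⟩, rfl, rfl⟩
    · simp only [apply_nsmul_eq_pow hadd hone, hx]
      rw [← pow_mul, mul_pow, ← pow_mul, ← pow_mul, mul_comm k₀, mul_comm l₀]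
    · simp only [apply_nsmul_eq_pow hadd hone, hy]
      rw [← pow_mul, mul_pow, ← pow_mul, ← pow_mul, mul_comm k₀, mul_comm l₀, mul_comm M]
  · rintro ⟨k', l', x, y⟩ ht ⟨k'', l'', x', y'⟩ ht' (rfl : k' = k'') (rfl : l' = l'')
    have h1 := hbd ht ht'.1.1
    have h2 := hbd ht ht'.1.2
    have h3 := hbd ht' ht.1.1
    have h4 := hbd ht' ht.1.2
    have hx : φ x = φ x' := le_antisymm h3.2 h1.2
    have hy : φ y = φ y' := le_antisymm h2.1 h4.1
    rw [hψ, hψ, hx, hy]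
  · rintro ⟨k', l', x, y⟩ ht (rfl : l' = 0) (hk : 0 < k')
    have := ha k' hk x y (by simpa using ht.1.1) (by simpa using ht.1.2)
    rw [hψ]
    linarith
  · rintro ⟨k', l', x, y⟩ ht (rfl : k' = 0) (hl : 0 < l')
    have h1 := (hbd ht (z := l' • xb) (by simp [apply_nsmul_eq_pow hadd hone, hxb])).2
    have h2 := (hbd ht (z := l' • yb) (by simp [apply_nsmul_eq_pow hadd hone, hyb])).1
    rw [hψ]
    simp only [map_nsmul, nsmul_eq_mul] at h1 h2
    have h3 : (n : ℤ) * (l' * φ xb) ≤ n * φ x := mul_le_mul_of_nonneg_left h1 (by positivity)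
    have h4 : (m : ℤ) * φ y ≤ m * (l' * φ yb) := mul_le_mul_of_nonneg_left h2 (by positivity)
    have h5 : (l' : ℤ) * (m * φ yb) < l' * (n * φ xb) :=
      mul_lt_mul_of_pos_left hb (by exact_mod_cast hl)
    linarith

end Stable

lemma Associates.irreducible_mk_iff {M : Type*} [CommMonoid M] {a : M} :
    Irreducible (Associates.mk a) ↔ Irreducible a := by
  simp only [irreducible_iff, Associates.isUnit_mk, Associates.forall_associated,
    Associates.mk_mul_mk, Associates.mk_eq_mk_iff_associated, Associated.comm (x := a)]
  apply Iff.rfl.and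
  constructor
  · rintro h x y rfl
    exact h _ _ <| .refl _
  · rintro h x y ⟨u, rfl⟩
    simpa using h (mul_assoc _ _ _)

lemma Associates.isCancelMul_of_cancelCommMonoid (M : Type*) [CancelCommMonoid M] :
    IsCancelMul (Associates M) := by
  have : IsLeftCancelMul (Associates M) := by
    refine ⟨fun a b c h => ?_⟩
    obtain ⟨a, rfl⟩ := Associates.mk_surjective a
    obtain ⟨b, rfl⟩ := Associates.mk_surjective b
    obtain ⟨c, rfl⟩ := Associates.mk_surjective c
    simp only [Associates.mk_mul_mk, Associates.mk_eq_mk_iff_associated] at h ⊢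
    obtain ⟨v, hv⟩ := h
    rw [mul_assoc] at hv
    exact ⟨v, mul_left_cancel hv⟩
  exact CommMagma.IsLeftCancelMul.toIsCancelMul _

lemma card_mem_lengthSet {H : Type*} [CommMonoid H] {h : H} (hh : ¬ IsUnit h) (s : Multiset H)
    (hs : ∀ p ∈ s, Irreducible p) (hprod : Associated s.prod h) : s.card ∈ lengthSet H h := by
  obtain ⟨c, rfl⟩ := hprod
  rw [lengthSet, if_neg hh]
  obtain ⟨l, rfl⟩ : ∃ l : List H, (l : Multiset H) = s := ⟨s.toList, s.coe_toList⟩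
  simp only [Multiset.mem_coe, Multiset.prod_coe, Multiset.coe_card]
    at hs hh ⊢
  cases l with
  | nil => simp at hh
  | cons p l =>
    refine ⟨((p * c) :: l).get, fun i => ?_, ?_⟩
    · have hmem : ((p * c) :: l).get i ∈ (p * c) :: l := List.get_mem _ _
      rcases List.mem_cons.1 hmem with heq | hmem
      · rw [heq, irreducible_mul_units]
        exact hs p (by simp)
      · exact hs _ (List.mem_cons_of_mem _ hmem)
    · have := List.prod_ofFn (f := ((p * c) :: l).get)
      rw [List.ofFn_get] at this
      rw [List.prod_cons, mul_right_comm, ← List.prod_cons]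
      exact this

lemma prod_pow_eq_one_iff {A ι : Type*} [CommMonoid A] [Subsingleton Aˣ] [Fintype ι] {u : ι → A}
    (hu : ∀ i, Irreducible (u i)) (x : ι → ℕ) : ∏ i, u i ^ x i = 1 ↔ x = 0 := by
  constructor
  · intro h
    funext i
    have h1 : IsUnit (u i ^ x i) :=
      isUnit_of_dvd_one (h ▸ Finset.dvd_prod_of_mem (fun i => u i ^ x i) (Finset.mem_univ i))
    by_contra h0
    exact (hu i).not_isUnit ((isUnit_pow_iff h0).1 h1)
  · rintro rfl
    simp

lemma lengthSet_eq {H ι : Type*} [CommMonoid H] [Fintype ι] {u : ι → Associates H}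
    (hu : ∀ i, Irreducible (u i)) {h : H}
    (hall : ∀ p, Irreducible p → p ∣ Associates.mk h → ∃ i, u i = p) :
    lengthSet H h = {n | ∃ x : ι → ℕ, ∏ i, u i ^ x i = Associates.mk h ∧ ∑ i, x i = n} := by
  classical
  by_cases hh : IsUnit h
  · rw [lengthSet, if_pos hh, Associates.mk_eq_one.2 hh]
    ext n
    simp only [Set.mem_singleton_iff, Set.mem_ofPred_eq, prod_pow_eq_one_iff hu]
    constructor
    · rintro rfl
      exact ⟨0, rfl, by simp⟩
    · rintro ⟨x, rfl, rfl⟩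
      simp
  · ext n
    constructor
    · rw [lengthSet, if_neg hh]
      rintro ⟨f, hf, rfl⟩
      have hmk : Associates.mk (∏ i, f i) = ∏ i, Associates.mk (f i) :=
        map_prod (Associates.mkMonoidHom (M := H)) f Finset.univ
      have hex : ∀ t, ∃ i, u i = Associates.mk (f t) := fun t =>
        hall _ (Associates.irreducible_mk_iff.2 (hf t))
          (Associates.mk_dvd_mk.2 (Finset.dvd_prod_of_mem f (Finset.mem_univ t)))
      choose j hj using hex
      refine ⟨fun i => (Finset.univ.filter (fun t => j t = i)).card, ?_, ?_⟩
      · rw [hmk, ← Finset.prod_fiberwise Finset.univ j]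
        refine Finset.prod_congr rfl fun i _ => ?_
        rw [← Finset.prod_const]
        refine Finset.prod_congr rfl fun t ht => ?_
        rw [← hj, (Finset.mem_filter.1 ht).2]
      · have := Finset.card_eq_sum_card_fiberwise (f := j) (s := Finset.univ) (t := Finset.univ)
          (by simp)
        simpa using this.symm
    · rintro ⟨x, hx, rfl⟩
      choose v hv using fun i => Associates.mk_surjective (u i)
      have := card_mem_lengthSet hh (∑ i, Multiset.replicate (x i) (v i)) ?_ ?_
      · simpa using this
      · intro p hp
        obtain ⟨i, -, hi⟩ := Multiset.mem_sum.1 hp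
        rw [Multiset.eq_of_mem_replicate hi, ← Associates.irreducible_mk_iff, hv]
        exact hu i
      · rw [← Associates.mk_eq_mk_iff_associated, ← hx, Multiset.prod_sum]
        have hmk := map_prod (Associates.mkMonoidHom (M := H)) (fun i => v i ^ x i) Finset.univ
        simp only [Associates.mkMonoidHom_apply, Associates.mk_pow, hv] at hmk
        simpa using hmk

/-- An element of positive elasticity has a finite set of lengths, consisting of positive numbers,
so the extrema defining its elasticity are attained. -/
lemma lengthSet_of_elasticity_pos {H : Type*} [CommMonoid H] {h : H} (hh : ¬ IsUnit h)
    (hpos : 0 < elasticity H h) :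
    BddAbove (lengthSet H h) ∧ (lengthSet H h).Nonempty ∧ 0 < sInf (lengthSet H h) := by
  rw [elasticity, if_neg hh] at hpos
  have h1 : sSup (lengthSet H h) ≠ 0 := by
    intro h0
    simp [h0] at hpos
  have h2 : sInf (lengthSet H h) ≠ 0 := by
    intro h0
    simp [h0] at hpos
  refine ⟨?_, Nat.nonempty_of_pos_sInf (Nat.pos_of_ne_zero h2), Nat.pos_of_ne_zero h2⟩
  by_contra hb
  exact h1 (Nat.sSup_of_not_bddAbove hb)

/-- A locally finitely generated monoid with `inf R̄(H) = 1` is fully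
elastic: every rational `q` with `1 < q < ρ(H)` is the elasticity of some element. -/
theorem statement1 (H : Type*) [CancelCommMonoid H]
    (hlfg : LocallyFinitelyGenerated H) (hinf : sInf (asympSet H) = 1)
    (q : ℚ) (h1 : 1 < q) (h2 : ((q : ℝ) : EReal) < monoidElasticity H) :
    ∃ a : H, elasticity H a = (q : ℝ) := by
  have hq1 : (1 : ℝ) < (q : ℝ) := by exact_mod_cast h1
  obtain ⟨b, hqb⟩ := lt_iSup_iff.1 h2
  rw [EReal.coe_lt_coe_iff] at hqb
  have hbu : ¬ IsUnit b := by
    intro hu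
    rw [elasticity, if_pos hu] at hqb
    linarith
  obtain ⟨r, hr, hrq⟩ : ∃ r ∈ asympSet H, r < ((q : ℝ) : EReal) := by
    rw [← sInf_lt_iff, hinf]
    exact_mod_cast hq1
  have hr1 : 1 ≤ r := hinf ▸ sInf_le hr
  obtain ⟨a₀, ha₀, htend⟩ := hr
  have hhalf : ((0 : ℝ) : EReal) < r := lt_of_lt_of_le (by exact_mod_cast zero_lt_one) hr1
  obtain ⟨N, hN⟩ := eventually_atTop.1
    ((htend.eventually_lt_const hrq).and (htend.eventually_const_lt hhalf))
  obtain ⟨a, hau, ha⟩ : ∃ a : H, ¬ IsUnit a ∧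
      ∀ k, 0 < k → elasticity H (a ^ k) < q ∧ 0 < elasticity H (a ^ k) := by
    refine ⟨a₀ ^ (N + 1), fun h => ha₀ ((isUnit_pow_iff N.succ_ne_zero).1 h), fun k hk => ?_⟩
    have := hN ((N + 1) * k) (by nlinarith)
    rw [EReal.coe_lt_coe_iff, EReal.coe_lt_coe_iff, pow_mul] at this
    exact this
  have hfin := hlfg (a * b)
  let ι := {u : Associates H // Irreducible u ∧ ∃ n : ℕ, u ∣ Associates.mk ((a * b) ^ n)}
  have : Fintype ι := hfin.fintype
  have := Associates.isCancelMul_of_cancelCommMonoid H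
  let P : (ι → ℕ) → Associates H := fun x => ∏ i, i.1 ^ x i
  have hu : ∀ i : ι, Irreducible i.1 := fun i => i.2.1
  have hL : ∀ k l, lengthSet H (a ^ k * b ^ l) =
      {n | ∃ x, P x = Associates.mk (a ^ k * b ^ l) ∧ ∑ i, x i = n} := by
    refine fun k l => lengthSet_eq hu fun p hp hdvd => ⟨⟨p, hp, k + l, hdvd.trans ?_⟩, rfl⟩
    rw [Associates.mk_dvd_mk, mul_pow]
    exact mul_dvd_mul (pow_dvd_pow a (by omega)) (pow_dvd_pow b (by omega))
  have hLa : ∀ k, lengthSet H (a ^ k) = {n | ∃ x, P x = Associates.mk a ^ k ∧ ∑ i, x i = n} := by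
    intro k
    simpa [Associates.mk_pow] using hL k 0
  have hLb : lengthSet H b = {n | ∃ x, P x = Associates.mk b ∧ ∑ i, x i = n} := by
    simpa using hL 0 1
  let φ : (ι → ℕ) →+ ℤ :=
    { toFun := fun x => ((∑ i, x i : ℕ) : ℤ)
      map_zero' := by simp
      map_add' := fun x y => by simp [Finset.sum_add_distrib] }
  have hφ : ∀ x, φ x = ((∑ i, x i : ℕ) : ℤ) := fun x => rfl
  have hadd : ∀ x y, P (x + y) = P x * P y := fun x y => by
    simp only [P, Pi.add_apply, pow_add, Finset.prod_mul_distrib]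
  have hone : ∀ x, P x = 1 ↔ x = 0 := prod_pow_eq_one_iff hu
  obtain ⟨m, hm⟩ := Int.eq_ofNat_of_zero_le (a := q.num) (Rat.num_nonneg.2 (by linarith))
  have hden : (0 : ℝ) < q.den := by exact_mod_cast q.den_pos
  have hqmn : (q : ℝ) = m / q.den := by
    rw [Rat.cast_def, hm]
    simp
  obtain ⟨na, hna⟩ := (lengthSet_of_elasticity_pos (by simpa using hau) (ha 1 one_pos).2).2.1
  rw [hLa] at hna
  obtain ⟨xa, hxa, -⟩ := hna
  obtain ⟨hbbdd, hbne, hbpos⟩ := lengthSet_of_elasticity_pos hbu (by linarith)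
  have hmem : ∀ n ∈ lengthSet H b, ∃ x, P x = Associates.mk b ∧ ∑ i, x i = n := fun n hn => by
    rwa [hLb] at hn
  obtain ⟨xb, hxb, hxbs⟩ := hmem _ (Nat.sSup_mem hbne hbbdd)
  obtain ⟨yb, hyb, hybs⟩ := hmem _ (Nat.sInf_mem hbne)
  obtain ⟨k, l, hkl, x, y, hx, hy, hext, heq⟩ := exists_length_ratio_eq (P := P) hadd hone φ
    (a := Associates.mk a) (b := Associates.mk b) xa (by simpa using hxa) m q.den
    (by
      intro k hk x y hx hy
      have hku : ¬ IsUnit (a ^ k) := fun h => hau ((isUnit_pow_iff hk.ne').1 h)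
      obtain ⟨hlt, hpos⟩ := ha k hk
      obtain ⟨hbdd, -, hinfpos⟩ := lengthSet_of_elasticity_pos hku hpos
      have hxle : ∑ i, x i ≤ sSup (lengthSet H (a ^ k)) :=
        le_csSup hbdd (by rw [hLa]; exact ⟨x, hx, rfl⟩)
      have hyle : sInf (lengthSet H (a ^ k)) ≤ ∑ i, y i :=
        Nat.sInf_le (by rw [hLa]; exact ⟨y, hy, rfl⟩)
      rw [elasticity, if_neg hku, hqmn, div_lt_div_iff₀ (by exact_mod_cast hinfpos) hden] at hlt
      have hlt' : sSup (lengthSet H (a ^ k)) * q.den < m * sInf (lengthSet H (a ^ k)) := by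
        exact_mod_cast hlt
      rw [hφ, hφ]
      norm_cast
      calc q.den * ∑ i, x i ≤ q.den * sSup (lengthSet H (a ^ k)) := Nat.mul_le_mul_left _ hxle
        _ < m * sInf (lengthSet H (a ^ k)) := by rwa [mul_comm]
        _ ≤ m * ∑ i, y i := Nat.mul_le_mul_left _ hyle)
    xb yb hxb hyb
    (by
      rw [elasticity, if_neg hbu, hqmn, div_lt_div_iff₀ hden (by exact_mod_cast hbpos)] at hqb
      rw [hφ, hφ, hxbs, hybs, mul_comm (q.den : ℤ)]
      exact_mod_cast hqb)
  rw [← Associates.mk_pow, ← Associates.mk_pow, Associates.mk_mul_mk] at hx hy hext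
  have hnu : ¬ IsUnit (a ^ k * b ^ l) := by
    rw [IsUnit.mul_iff]
    rintro ⟨hk, hl⟩
    rcases Nat.eq_zero_or_pos k with h0 | h0
    · exact hbu ((isUnit_pow_iff (by omega)).1 hl)
    · exact hau ((isUnit_pow_iff h0.ne').1 hk)
  have hsup : sSup (lengthSet H (a ^ k * b ^ l)) = ∑ i, x i := by
    rw [hL]
    refine IsGreatest.csSup_eq ⟨⟨x, hx, rfl⟩, ?_⟩
    rintro n ⟨z, hz, rfl⟩
    have := (hext z hz).2
    rw [hφ, hφ] at this
    exact_mod_cast this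
  have hsinf : sInf (lengthSet H (a ^ k * b ^ l)) = ∑ i, y i := by
    rw [hL]
    refine IsLeast.csInf_eq ⟨⟨y, hy, rfl⟩, ?_⟩
    rintro n ⟨z, hz, rfl⟩
    have := (hext z hz).1
    rw [hφ, hφ] at this
    exact_mod_cast this
  have hypos : 0 < ∑ i, y i := by
    rw [Nat.pos_iff_ne_zero]
    intro h0
    have hy0 : y = 0 := funext fun i => (Finset.sum_eq_zero_iff.1 h0) i (Finset.mem_univ i)
    rw [(hone y).2 hy0, eq_comm, Associates.mk_eq_one] at hy
    exact hnu hy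
  refine ⟨a ^ k * b ^ l, ?_⟩
  rw [elasticity, if_neg hnu, hsup, hsinf, hqmn,
    div_eq_div_iff (by exact_mod_cast hypos.ne') hden.ne', mul_comm]
  rw [hφ, hφ] at heq
  exact_mod_cast heq
end

section
/- Let H be a monoid such that the reduced quotient H_red = H/H^× is finitely generated, and let r = inf R̄(H). Then every rational number q with r ≤ q ≤ ρ(H) is the elasticity of some element: there exists a ∈ H with ρ(a) = q. -/
open Filter Topology

open Finset in
/-- If each `P (single i 1)` has a multiple with two preimages whose `D`-ratio exceeds `s / t`, then
this excess is uniform over all of `ι → ℕ`. -/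
theorem exists_uniform_excess {ι B : Type*} [Fintype ι] [DecidableEq ι] [AddCommMonoid B]
    (P : (ι → ℕ) →+ B) (D : (ι → ℕ) →+ ℕ) (hD : ∀ i, D (Pi.single i 1) = 1) (s t : ℕ)
    (h : ∀ i, ∃ k : ℕ, 0 < k ∧ ∃ z w, P z = k • P (Pi.single i 1) ∧ P w = k • P (Pi.single i 1) ∧
      s * D w < t * D z) :
    ∃ K : ℕ, 0 < K ∧ ∀ x, ∃ Z W, P Z = K • P x ∧ P W = K • P x ∧ s * D W + D x ≤ t * D Z := by
  choose k hk z w hz hw hlt using h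
  refine ⟨∏ i, k i, prod_pos fun i _ => hk i, fun x => ?_⟩
  have hx : x = ∑ i, x i • (Pi.single i 1 : ι → ℕ) := by
    ext j
    simp [Finset.sum_apply, Pi.single_apply]
  have hK : ∀ i, (∏ j ∈ univ.erase i, k j) * k i = ∏ i, k i := fun i =>
    prod_erase_mul _ _ (mem_univ i)
  refine ⟨∑ i, x i • (∏ j ∈ univ.erase i, k j) • z i,
    ∑ i, x i • (∏ j ∈ univ.erase i, k j) • w i, ?_, ?_, ?_⟩
  · conv_rhs => rw [hx]
    simp only [map_sum, map_nsmul, hz, smul_sum]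
    refine sum_congr rfl fun i _ => ?_
    rw [← hK i]
    simp only [smul_smul]
    ring_nf
  · conv_rhs => rw [hx]
    simp only [map_sum, map_nsmul, hw, smul_sum]
    refine sum_congr rfl fun i _ => ?_
    rw [← hK i]
    simp only [smul_smul]
    ring_nf
  · have hDx : D x = ∑ i, x i := by
      conv_lhs => rw [hx]
      simp only [map_sum, map_nsmul, hD, smul_eq_mul, mul_one]
    rw [hDx]
    simp only [map_sum, map_nsmul, mul_sum, ← sum_add_distrib, smul_eq_mul]
    refine sum_le_sum fun i _ => ?_
    have h1 : 1 ≤ ∏ j ∈ univ.erase i, k j := prod_pos fun i _ => hk i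
    have h2 := hlt i
    generalize ∏ j ∈ univ.erase i, k j = m at *
    calc _ = x i * m * (s * D (w i)) + x i * 1 := by ring
      _ ≤ x i * m * (s * D (w i)) + x i * m := by gcongr
      _ = x i * m * (s * D (w i) + 1) := by ring
      _ ≤ x i * m * (t * D (z i)) := by gcongr; exact h2
      _ = _ := by ring

/-- If the `D`-ratio of any two preimages of a nonzero element is less than `s / t`, then it is
bounded away from `s / t`. -/
theorem exists_uniform_deficit {ι B : Type*} [Fintype ι] [AddCommMonoid B] [IsCancelAdd B]
    (P : (ι → ℕ) →+ B) (hP : ∀ z, P z = 0 → z = 0) (D : (ι → ℕ) →+ ℕ) (s t : ℕ)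
    (h : ∀ z w, P z = P w → w ≠ 0 → t * D z < s * D w) :
    ∃ N : ℕ, 0 < N ∧ ∀ z w, P z = P w → N * (t * D z) + D w ≤ N * (s * D w) := by
  obtain ⟨G, hG⟩ := AddSubmonoid.fg_eqLocusM
    (P.comp (AddMonoidHom.fst (ι → ℕ) (ι → ℕ))) (P.comp (AddMonoidHom.snd (ι → ℕ) (ι → ℕ)))
  refine ⟨G.sup (fun p => D p.2) + 1, by omega, fun z w hzw => ?_⟩
  have hmem : (z, w) ∈ AddSubmonoid.closure (G : Set ((ι → ℕ) × (ι → ℕ))) := by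
    rw [hG]; exact hzw
  have key : ∀ p ∈ AddSubmonoid.closure (G : Set ((ι → ℕ) × (ι → ℕ))),
      (G.sup (fun p => D p.2) + 1) * (t * D p.1) + D p.2 ≤
        (G.sup (fun p => D p.2) + 1) * (s * D p.2) := by
    intro p hp
    induction hp using AddSubmonoid.closure_induction with
    | mem p hp =>
      have hpe : P p.1 = P p.2 := by
        have : p ∈ AddSubmonoid.closure (G : Set ((ι → ℕ) × (ι → ℕ))) :=
          AddSubmonoid.subset_closure hp
        rw [hG] at this
        exact this
      by_cases hw : p.2 = 0
      · have : p.1 = 0 := hP _ (by rw [hpe, hw, map_zero])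
        simp [hw, this]
      have h1 := h _ _ hpe hw
      have h2 : D p.2 ≤ G.sup (fun p => D p.2) := Finset.le_sup (f := fun p => D p.2) hp
      calc _ ≤ (G.sup (fun p => D p.2) + 1) * (t * D p.1) + (G.sup (fun p => D p.2) + 1) := by
            gcongr; omega
        _ = (G.sup (fun p => D p.2) + 1) * (t * D p.1 + 1) := by ring
        _ ≤ _ := by gcongr; omega
    | zero => simp
    | add p p' _ _ hp hp' =>
      simp only [Prod.fst_add, Prod.snd_add, map_add]
      nlinarith
  exact key _ hmem

/-- Interpolation between an element all of whose multiples have `D`-ratio at most `s / t` and an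
element with `D`-ratio at least `s / t`. -/
theorem exists_maximal_ratio_eq {ι B : Type*} [Fintype ι] [AddCommMonoid B] [IsCancelAdd B]
    (P : (ι → ℕ) →+ B) (hP : ∀ z, P z = 0 → z = 0) (D : (ι → ℕ) →+ ℕ) (s t : ℕ)
    (x : ι → ℕ) (hx : x ≠ 0)
    (hA : ∀ (k : ℕ) z w, P z = k • P x → P w = k • P x → t * D z ≤ s * D w)
    (z₀ w₀ : ι → ℕ) (hzw : P z₀ = P w₀) (hw₀ : w₀ ≠ 0) (hB : s * D w₀ ≤ t * D z₀) :
    ∃ z w, P z = P w ∧ w ≠ 0 ∧ t * D z = s * D w ∧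
      ∀ z' w', P z' = P w → P w' = P w → t * D z' ≤ s * D w' := by
  let f : (ι → ℕ) × (ι → ℕ) × ℕ × ℕ × ℕ →+ B × B × ℕ :=
    { toFun := fun p => (P p.1, P p.2.1, t * D p.1)
      map_zero' := by simp
      map_add' := fun p p' => by simp [mul_add] }
  let g : (ι → ℕ) × (ι → ℕ) × ℕ × ℕ × ℕ →+ B × B × ℕ :=
    { toFun := fun p => (P p.2.1, p.2.2.1 • P x + p.2.2.2.1 • P w₀, s * D p.2.1 + p.2.2.2.2)
      map_zero' := by simp
      map_add' := fun p p' => by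
        simp only [Prod.fst_add, Prod.snd_add, map_add, Prod.mk_add_mk, add_smul, mul_add,
          Prod.mk.injEq]
        exact ⟨trivial, by abel, by ring⟩ }
  have hmem : ∀ p : (ι → ℕ) × (ι → ℕ) × ℕ × ℕ × ℕ, p ∈ f.eqLocusM g ↔ P p.1 = P p.2.1 ∧
      P p.2.1 = p.2.2.1 • P x + p.2.2.2.1 • P w₀ ∧ t * D p.1 = s * D p.2.1 + p.2.2.2.2 := by
    intro p
    simp [f, g, AddMonoidHom.eqLocusM]
  obtain ⟨G, hG⟩ := AddSubmonoid.fg_eqLocusM f g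
  have hGm : ∀ p ∈ G, p ∈ f.eqLocusM g := fun p hp => hG ▸ AddSubmonoid.subset_closure hp
  suffices hmain : ∃ p ∈ f.eqLocusM g, ¬ (p.2.2.1 = 0 ∧ p.2.2.2.1 = 0) ∧
      ∀ z' w', P z' = P p.2.1 → P w' = P p.2.1 → t * D z' ≤ s * D w' by
    obtain ⟨p, hp, hne, hmax⟩ := hmain
    obtain ⟨h1, h2, h3⟩ := (hmem p).1 hp
    refine ⟨p.1, p.2.1, h1, ?_, le_antisymm (hmax _ _ h1 rfl) (by omega), hmax⟩
    intro h0
    rw [h0, map_zero, ← map_nsmul, ← map_nsmul, ← map_add] at h2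
    have h4 := hP _ h2.symm
    rw [add_eq_zero, smul_eq_zero, smul_eq_zero] at h4
    tauto
  by_cases hcase : ∃ p ∈ f.eqLocusM g, p.2.2.2.1 = 0 ∧ p.2.2.1 ≠ 0
  · obtain ⟨p, hp, hl, hk⟩ := hcase
    obtain ⟨h1, h2, h3⟩ := (hmem p).1 hp
    rw [hl, zero_smul, add_zero] at h2
    exact ⟨p, hp, by tauto, fun z' w' hz' hw' =>
      hA p.2.2.1 z' w' (hz'.trans h2) (hw'.trans h2)⟩
  push Not at hcase
  have hpos : ∃ p ∈ G, 0 < p.2.2.2.1 := by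
    by_contra! hcon
    have key : ∀ p ∈ AddSubmonoid.closure (G : Set ((ι → ℕ) × (ι → ℕ) × ℕ × ℕ × ℕ)), p.2.2.2.1 = 0 := by
      intro p hp
      induction hp using AddSubmonoid.closure_induction with
      | mem p hp => exact Nat.le_zero.1 (hcon p hp)
      | zero => rfl
      | add p p' _ _ hp hp' => simp [hp, hp']
    have := key (z₀, w₀, 0, 1, t * D z₀ - s * D w₀) (by
      rw [hG, hmem]
      refine ⟨hzw, by simp, ?_⟩
      simp only
      omega)
    simp at this
  obtain ⟨p, hp, hpmax⟩ := Finset.exists_max_image (G.filter fun p => 0 < p.2.2.2.1)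
    (fun p => (p.2.2.1 : ℚ) / p.2.2.2.1)
    (by obtain ⟨p, hp⟩ := hpos; exact ⟨p, Finset.mem_filter.2 hp⟩)
  obtain ⟨hpG, hpl⟩ := Finset.mem_filter.1 hp
  have slope : ∀ p' ∈ AddSubmonoid.closure (G : Set ((ι → ℕ) × (ι → ℕ) × ℕ × ℕ × ℕ)),
      p'.2.2.1 * p.2.2.2.1 ≤ p.2.2.1 * p'.2.2.2.1 := by
    intro p' hp'
    induction hp' using AddSubmonoid.closure_induction with
    | mem p' hp' =>
      rcases Nat.eq_zero_or_pos p'.2.2.2.1 with h0 | h0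
      · rw [hcase p' (hGm p' hp') h0]
        simp
      · have := hpmax p' (Finset.mem_filter.2 ⟨hp', h0⟩)
        rw [div_le_div_iff₀ (by exact_mod_cast h0) (by exact_mod_cast hpl)] at this
        exact_mod_cast this
    | zero => simp
    | add p₁ p₂ _ _ h₁ h₂ =>
      simp only [Prod.fst_add, Prod.snd_add]
      nlinarith
  refine ⟨p, hGm p hpG, by omega, fun z' w' hz' hw' => ?_⟩
  by_contra! hlt
  obtain ⟨-, h2, -⟩ := (hmem p).1 (hGm p hpG)
  have hle : s * D (x + (s * D x) • w') ≤ t * D (x + (s * D x) • z') := by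
    simp only [map_add, map_nsmul, smul_eq_mul]
    have : s * D x * (s * D w' + 1) ≤ s * D x * (t * D z') := by gcongr; omega
    nlinarith
  have := slope (x + (s * D x) • z', x + (s * D x) • w', s * D x * p.2.2.1 + 1,
    s * D x * p.2.2.2.1,
    t * D (x + (s * D x) • z') - s * D (x + (s * D x) • w')) (by
      rw [hG, hmem]
      refine ⟨?_, ?_, ?_⟩
      · simp only [map_add, map_nsmul, hz', hw']
      · simp only [map_add, map_nsmul, hw', h2, smul_add, add_smul, smul_smul, one_smul]
        abel
      · simp only
        omega)
  simp only at this
  nlinarith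

theorem mem_lengthSet_iff_multiset {H : Type*} [CommMonoid H] {a : H} (ha : ¬ IsUnit a) {k : ℕ} :
    k ∈ lengthSet H a ↔
      ∃ m : Multiset H, (∀ x ∈ m, Irreducible x) ∧ m.card = k ∧ m.prod = a := by
  simp only [lengthSet, if_neg ha, Set.mem_ofPred_eq]
  constructor
  · rintro ⟨f, hf, rfl⟩
    exact ⟨Finset.univ.val.map f, by simpa using hf, by simp, rfl⟩
  · rintro ⟨m, hm, rfl, rfl⟩
    induction m using Quotient.inductionOn with
    | h l =>
      refine ⟨fun i => l.get i, fun i => hm _ (List.get_mem l i), ?_⟩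
      exact (congrArg List.prod (List.ofFn_get l)).symm.trans List.prod_ofFn

theorem irreducible_associates_mk {H : Type*} [CommMonoid H] {a : H} :
    Irreducible (Associates.mk a) ↔ Irreducible a := by
  simp only [irreducible_iff, Associates.isUnit_mk, Associates.forall_associated,
    Associates.mk_mul_mk, Associates.mk_eq_mk_iff_associated]
  refine and_congr_right fun _ => ⟨fun h b c hbc => h b c (hbc ▸ Associated.refl _), ?_⟩
  rintro h b c ⟨u, hu⟩
  have := @h b (c * ↑u⁻¹) (by rw [← mul_assoc, ← hu, Units.mul_inv_cancel_right])
  simpa using this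

section Factorizations

variable (H : Type*) [CancelCommMonoid H]

instance Associates.isCancelMul_of_cancelCommMonoid_s2 : IsCancelMul (Associates H) :=
  have : IsLeftCancelMul (Associates H) := ⟨by
    simp only [IsLeftRegular, Function.Injective, Associates.forall_associated]
    intro a b c
    simp only [Associates.mk_mul_mk, Associates.mk_eq_mk_iff_associated]
    rintro ⟨u, hu⟩
    exact ⟨u, mul_left_cancel (by rw [← hu, mul_assoc])⟩⟩
  CommMagma.IsLeftCancelMul.toIsCancelMul (Associates H)

/-- The atoms of the reduced monoid. -/
abbrev ReducedAtom : Type _ := {p : Associates H // Irreducible p}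

variable [Fintype (ReducedAtom H)]

/-- The factorization homomorphism from the free abelian monoid on the reduced atoms. -/
noncomputable def factorHom : (ReducedAtom H → ℕ) →+ Additive (Associates H) where
  toFun z := ∑ i, z i • Additive.ofMul i.1
  map_zero' := by simp
  map_add' z w := by simp [add_smul, Finset.sum_add_distrib]

/-- The length of a factorization. -/
def factorLength : (ReducedAtom H → ℕ) →+ ℕ where
  toFun z := ∑ i, z i
  map_zero' := by simp
  map_add' z w := by simp [Finset.sum_add_distrib]

theorem factorLength_eq_zero {z : ReducedAtom H → ℕ} : factorLength H z = 0 ↔ z = 0 := by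
  simp [factorLength, funext_iff]

theorem factorLength_single [DecidableEq (ReducedAtom H)] (i : ReducedAtom H) :
    factorLength H (Pi.single i 1) = 1 := by
  simp [factorLength]

theorem factorHom_single [DecidableEq (ReducedAtom H)] (i : ReducedAtom H) :
    factorHom H (Pi.single i 1) = Additive.ofMul i.1 := by
  simp [factorHom, Pi.single_apply]

theorem exists_multiset_of_factorHom (z : ReducedAtom H → ℕ) :
    ∃ m : Multiset H, (∀ x ∈ m, Irreducible x) ∧ m.card = factorLength H z ∧
      Additive.ofMul (Associates.mk m.prod) = factorHom H z := by
  have hout : ∀ i : ReducedAtom H, ∃ u : H, Associates.mk u = i.1 :=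
    fun i => Associates.mk_surjective i.1
  choose u hu using hout
  refine ⟨∑ i, Multiset.replicate (z i) (u i), ?_, ?_, ?_⟩
  · intro x hx
    obtain ⟨i, -, hi⟩ := Multiset.mem_sum.1 hx
    rw [Multiset.eq_of_mem_replicate hi, ← irreducible_associates_mk]
    exact (hu i).symm ▸ i.2
  · simp [factorLength]
  · simp only [Multiset.prod_sum, Multiset.prod_replicate, factorHom, ← hu, AddMonoidHom.coe_mk,
      ZeroHom.coe_mk]
    exact (map_prod (Associates.mkMonoidHom (M := H)) _ _).trans
      (Finset.prod_congr rfl fun i _ => Associates.mk_pow _ _)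

theorem exists_factorHom_of_multiset (m : Multiset H) (hm : ∀ x ∈ m, Irreducible x) :
    ∃ z, factorLength H z = m.card ∧
      factorHom H z = Additive.ofMul (Associates.mk m.prod) := by
  classical
  induction m using Multiset.induction_on with
  | empty => exact ⟨0, by simp, by simp⟩
  | cons x m ih =>
    obtain ⟨z, hz, hz'⟩ := ih fun y hy => hm y (Multiset.mem_cons_of_mem hy)
    have hx : Irreducible (Associates.mk x) :=
      irreducible_associates_mk.2 (hm x (Multiset.mem_cons_self x m))
    refine ⟨Pi.single ⟨Associates.mk x, hx⟩ 1 + z, ?_, ?_⟩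
    · rw [map_add, factorLength_single, hz, Multiset.card_cons, add_comm]
    · rw [map_add, factorHom_single, hz', Multiset.prod_cons, ← Associates.mk_mul_mk, ofMul_mul]

theorem eq_zero_of_factorHom_eq_zero (z : ReducedAtom H → ℕ) (hz : factorHom H z = 0) : z = 0 := by
  obtain ⟨m, hm, hcard, hprod⟩ := exists_multiset_of_factorHom H z
  rw [hz, ofMul_eq_zero, Associates.mk_eq_one] at hprod
  rw [← factorLength_eq_zero, ← hcard, Multiset.card_eq_zero]
  refine Multiset.eq_zero_of_forall_notMem fun x hx => (hm x hx).not_isUnit ?_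
  exact isUnit_of_dvd_unit (Multiset.dvd_prod hx) hprod

theorem mem_lengthSet_iff {a : H} (ha : ¬ IsUnit a) {k : ℕ} :
    k ∈ lengthSet H a ↔
      ∃ z, factorLength H z = k ∧ factorHom H z = Additive.ofMul (Associates.mk a) := by
  rw [mem_lengthSet_iff_multiset ha]
  constructor
  · rintro ⟨m, hm, rfl, rfl⟩
    exact exists_factorHom_of_multiset H m hm
  · rintro ⟨z, rfl, hz⟩
    obtain ⟨m, hm, hcard, hprod⟩ := exists_multiset_of_factorHom H z
    rw [hz, Additive.ofMul.apply_eq_iff_eq, Associates.mk_eq_mk_iff_associated] at hprod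
    obtain ⟨u, hu⟩ := hprod
    rcases m.empty_or_exists_mem with rfl | ⟨x, hx⟩
    · exact absurd ⟨u, by simpa using hu⟩ ha
    obtain ⟨m, rfl⟩ := Multiset.exists_cons_of_mem hx
    refine ⟨(x * u) ::ₘ m, ?_, by simpa using hcard, ?_⟩
    · intro y hy
      rcases Multiset.mem_cons.1 hy with rfl | hy
      · exact (irreducible_mul_units u).2 (hm x hx)
      · exact hm y (Multiset.mem_cons_of_mem hy)
    · rw [← hu, Multiset.prod_cons, Multiset.prod_cons, mul_right_comm]

theorem finite_factorizations (b : Additive (Associates H)) :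
    {z | factorHom H z = b}.Finite := by
  refine WellQuasiOrderedLE.finite_of_isAntichain fun z hz w hw hne hle => hne ?_
  obtain ⟨y, rfl⟩ := exists_add_of_le hle
  simp only [Set.mem_ofPred_eq] at hz hw
  rw [map_add, hz] at hw
  rw [eq_zero_of_factorHom_eq_zero H y (add_eq_left.1 hw), add_zero]

theorem factorHom_surjective [Monoid.FG (Associates H)] :
    Function.Surjective (factorHom H) := by
  classical
  let _ : CancelCommMonoid (Associates H) :=
    { (inferInstance : CommMonoid (Associates H)) with
      mul_left_cancel := fun a _ _ h => mul_left_cancel (a := a) h }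
  have htop := Submonoid.closure_irreducible (M := Associates H)
  intro b
  obtain ⟨b, rfl⟩ := Additive.ofMul.surjective b
  have hb : b ∈ Submonoid.closure {p : Associates H | Irreducible p} := by
    rw [htop]; trivial
  induction hb using Submonoid.closure_induction with
  | mem p hp => exact ⟨Pi.single ⟨p, hp⟩ 1, factorHom_single H _⟩
  | one => exact ⟨0, map_zero _⟩
  | mul p p' _ _ hp hp' =>
    obtain ⟨z, hz⟩ := hp
    obtain ⟨w, hw⟩ := hp'
    exact ⟨z + w, by rw [map_add, hz, hw]; rfl⟩

/-- The elasticity of a nonunit is the ratio of the lengths of a longest and of a shortest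
factorization. -/
theorem exists_elasticity_eq [Monoid.FG (Associates H)] {a : H} (ha : ¬ IsUnit a) :
    ∃ z w, factorHom H z = Additive.ofMul (Associates.mk a) ∧
      factorHom H w = Additive.ofMul (Associates.mk a) ∧ 0 < factorLength H w ∧
      elasticity H a = (factorLength H z : ℝ) / factorLength H w ∧
      ∀ y, factorHom H y = Additive.ofMul (Associates.mk a) →
        factorLength H y ≤ factorLength H z ∧ factorLength H w ≤ factorLength H y := by
  have hset : lengthSet H a =
      factorLength H '' {z | factorHom H z = Additive.ofMul (Associates.mk a)} := by
    ext k
    rw [mem_lengthSet_iff H ha]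
    simp [and_comm]
  have hfin : (lengthSet H a).Finite := hset ▸ (finite_factorizations H _).image _
  have hne : (lengthSet H a).Nonempty := by
    obtain ⟨z, hz⟩ := factorHom_surjective H (Additive.ofMul (Associates.mk a))
    exact ⟨_, (mem_lengthSet_iff H ha).2 ⟨z, rfl, hz⟩⟩
  obtain ⟨z, hz, hz'⟩ := (mem_lengthSet_iff H ha).1 (Nat.sSup_mem hne hfin.bddAbove)
  obtain ⟨w, hw, hw'⟩ := (mem_lengthSet_iff H ha).1 (Nat.sInf_mem hne)
  refine ⟨z, w, hz', hw', ?_, ?_, fun y hy => ?_⟩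
  · rw [Nat.pos_iff_ne_zero, Ne, factorLength_eq_zero]
    rintro rfl
    rw [map_zero, eq_comm, ofMul_eq_zero, Associates.mk_eq_one] at hw'
    exact ha hw'
  · rw [elasticity, if_neg ha, hz, hw]
  · have hmem := (mem_lengthSet_iff H ha).2 ⟨y, rfl, hy⟩
    rw [hz, hw]
    exact ⟨le_csSup hfin.bddAbove hmem, Nat.sInf_le hmem⟩

end Factorizations

theorem elasticity_nonneg {H : Type*} [CommMonoid H] (a : H) : 0 ≤ elasticity H a := by
  unfold elasticity
  split_ifs <;> positivity

/-- If `H_red = H/H^×` is finitely generated and `r = inf R̄(H)`, then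
every rational `q` with `r ≤ q ≤ ρ(H)` is the elasticity of some element of `H`. -/
theorem statement2 (H : Type*) [CancelCommMonoid H]
    (hfg : Monoid.FG (Associates H)) (r : EReal) (hr : r = sInf (asympSet H))
    (q : ℚ) (h1 : r ≤ ((q : ℝ) : EReal)) (h2 : ((q : ℝ) : EReal) ≤ monoidElasticity H) :
    ∃ a : H, elasticity H a = (q : ℝ) := by
  classical
  have : Fintype (ReducedAtom H) := finite_irreducible.fintype
  have hP := eq_zero_of_factorHom_eq_zero H
  have hq : 0 ≤ q := by
    have : (0 : EReal) ≤ ((q : ℝ) : EReal) := by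
      refine le_trans ?_ h1
      rw [hr]
      refine le_sInf fun y hy => ?_
      obtain ⟨a, -, ha⟩ := hy
      exact ge_of_tendsto' ha fun n => EReal.coe_nonneg.2 (elasticity_nonneg _)
    exact_mod_cast EReal.coe_nonneg.1 this
  obtain ⟨s, t, ht, rfl⟩ : ∃ s t : ℕ, 0 < t ∧ q = (s : ℚ) / t := by
    refine ⟨q.num.toNat, q.den, q.den_pos, ?_⟩
    have : ((q.num.toNat : ℤ) : ℚ) = q.num := by
      rw [Int.toNat_of_nonneg (Rat.num_nonneg.2 hq)]
    rw [Int.cast_natCast] at this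
    rw [this, Rat.num_div_den]
  have htR : (0 : ℝ) < t := by exact_mod_cast ht
  push_cast at h1 h2 ⊢
  -- an atom all of whose powers have elasticity at most `s / t`
  obtain ⟨i, hi⟩ : ∃ i : ReducedAtom H, ∀ (k : ℕ) z w,
      factorHom H z = k • factorHom H (Pi.single i 1) →
      factorHom H w = k • factorHom H (Pi.single i 1) →
      t * factorLength H z ≤ s * factorLength H w := by
    by_contra! hcon
    obtain ⟨K, hK, hex⟩ := exists_uniform_excess (factorHom H) (factorLength H)
      (factorLength_single H) s t (by
        intro i
        obtain ⟨k, z, w, hz, hw, hlt⟩ := hcon i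
        refine ⟨k, Nat.pos_of_ne_zero ?_, z, w, hz, hw, hlt⟩
        rintro rfl
        rw [zero_smul] at hz
        simp [hP z hz] at hlt)
    have hKR : (0 : ℝ) < K := by exact_mod_cast hK
    have hbound : ((((s + 1 / K : ℝ) / t : ℝ)) : EReal) ≤ sInf (asympSet H) := by
      refine le_sInf fun y hy => ?_
      obtain ⟨c, hc, hlim⟩ := hy
      have hsub : Tendsto (fun n : ℕ => (n + 1) * K) atTop atTop :=
        (tendsto_add_atTop_nat 1).atTop_mul_const' hK
      refine ge_of_tendsto' (hlim.comp hsub) fun n => EReal.coe_le_coe_iff.2 ?_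
      have hc1 : ¬ IsUnit (c ^ (n + 1)) := by rwa [isUnit_pow_iff (by omega)]
      have hc2 : ¬ IsUnit (c ^ ((n + 1) * K)) := by
        rwa [isUnit_pow_iff (Nat.mul_ne_zero (by omega) hK.ne')]
      obtain ⟨x, hx⟩ := factorHom_surjective H (Additive.ofMul (Associates.mk (c ^ (n + 1))))
      obtain ⟨z, w, hz, hw, hpos, heq, hext⟩ := exists_elasticity_eq H hc2
      obtain ⟨Z, W, hZ, hW, hle⟩ := hex x
      have hKx : K • factorHom H x = Additive.ofMul (Associates.mk (c ^ ((n + 1) * K))) := by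
        rw [hx, ← ofMul_pow, ← Associates.mk_pow, pow_mul]
      have e1 := (hext Z (hZ.trans hKx)).1
      have e2 := (hext W (hW.trans hKx)).2
      have e3 := (hext (K • x) (by rw [map_nsmul, hKx])).2
      rw [map_nsmul, smul_eq_mul] at e3
      have hposR : (0 : ℝ) < factorLength H w := by exact_mod_cast hpos
      rw [heq, div_le_div_iff₀ htR hposR]
      have e4 : s * factorLength H w + factorLength H x ≤ t * factorLength H z := by
        calc _ ≤ s * factorLength H W + factorLength H x := by gcongr
          _ ≤ t * factorLength H Z := hle
          _ ≤ _ := by gcongr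
      have e4R : (s : ℝ) * factorLength H w + factorLength H x ≤ t * factorLength H z := by
        exact_mod_cast e4
      have e3R : (factorLength H w : ℝ) / K ≤ factorLength H x := by
        rw [div_le_iff₀' hKR]
        exact_mod_cast e3
      calc (s + 1 / K : ℝ) * factorLength H w
          = s * factorLength H w + factorLength H w / K := by ring
        _ ≤ _ := by linarith
    have hlt := hbound.trans (hr ▸ h1)
    rw [EReal.coe_le_coe_iff, div_le_div_iff_of_pos_right htR] at hlt
    have : (0 : ℝ) < 1 / K := by positivity
    linarith
  -- an element of elasticity at least `s / t`
  obtain ⟨z₀, w₀, hzw, hw₀, hB⟩ : ∃ z w, factorHom H z = factorHom H w ∧ w ≠ 0 ∧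
      s * factorLength H w ≤ t * factorLength H z := by
    by_contra! hcon
    obtain ⟨N, hN, hdef⟩ := exists_uniform_deficit (factorHom H) hP (factorLength H) s t hcon
    have hNR : (0 : ℝ) < N := by exact_mod_cast hN
    have hst : N * t + 1 ≤ N * s := by
      simpa [factorLength_single] using hdef (Pi.single i 1) (Pi.single i 1) rfl
    have hstR : (N * t + 1 : ℝ) ≤ N * s := by exact_mod_cast hst
    have hbound : monoidElasticity H ≤ ((((s - 1 / N : ℝ) / t : ℝ)) : EReal) := by
      refine iSup_le fun a => EReal.coe_le_coe_iff.2 ?_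
      have hN1 : (N : ℝ) * (1 / N) = 1 := by field_simp
      by_cases ha : IsUnit a
      · rw [elasticity, if_pos ha, le_div_iff₀ htR]
        nlinarith
      · obtain ⟨z, w, hz, hw, hpos, heq, -⟩ := exists_elasticity_eq H ha
        have hposR : (0 : ℝ) < factorLength H w := by exact_mod_cast hpos
        rw [heq, div_le_div_iff₀ hposR htR]
        have h3 := hdef z w (hz.trans hw.symm)
        have h3R : (N : ℝ) * (t * factorLength H z) + factorLength H w ≤
          N * (s * factorLength H w) := by exact_mod_cast h3
        refine le_of_mul_le_mul_left ?_ hNR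
        calc (N : ℝ) * (factorLength H z * t)
            ≤ N * (s * factorLength H w) - (N * (1 / N)) * factorLength H w := by
              rw [hN1]; linarith
          _ = _ := by ring
    have hlt := h2.trans hbound
    rw [EReal.coe_le_coe_iff, div_le_div_iff_of_pos_right htR] at hlt
    have : (0 : ℝ) < 1 / N := by positivity
    linarith
  obtain ⟨z, w, hzw', hw, heq, hmax⟩ := exists_maximal_ratio_eq (factorHom H) hP (factorLength H)
    s t (Pi.single i 1) (by simp) hi z₀ w₀ hzw hw₀ hB
  obtain ⟨a, ha⟩ := Associates.mk_surjective (factorHom H w).toMul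
  have ha' : factorHom H w = Additive.ofMul (Associates.mk a) := by rw [ha]; rfl
  have hau : ¬ IsUnit a := by
    rw [← Associates.mk_eq_one, ha]
    exact fun h => hw (hP w h)
  obtain ⟨z₁, w₁, hz₁, hw₁, hpos, hel, hext⟩ := exists_elasticity_eq H hau
  refine ⟨a, ?_⟩
  have e1 := (hext z (hzw'.trans ha')).1
  have e2 := (hext w ha').2
  have e3 := hmax z₁ w₁ (hz₁.trans ha'.symm) (hw₁.trans ha'.symm)
  have e4 : t * factorLength H z ≤ t * factorLength H z₁ := by gcongr
  have e5 : s * factorLength H w₁ ≤ s * factorLength H w := by gcongr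
  have e6 : t * factorLength H z₁ = s * factorLength H w₁ := by omega
  have hposR : (0 : ℝ) < factorLength H w₁ := by exact_mod_cast hpos
  rw [hel, div_eq_div_iff hposR.ne' htR.ne', mul_comm]
  exact_mod_cast e6
end

section
/- Let n ∈ ℕ and let a_1, …, a_n ∈ ℕ be positive integers. If there exist x_1, …, x_n ∈ ℕ₀ and an integer t ≥ 1 such that a_1 x_1 + … + a_n x_n = t · a_1 ⋯ a_n, then there exist nonnegative integers x_i^{(j)} ∈ [0, x_i] for all i ∈ [1, n] and j ∈ [1, t] such that Σ_{j=1}^{t} x_i^{(j)} = x_i for every i ∈ [1, n] and Σ_{i=1}^{n} a_i x_i^{(j)} = a_1 ⋯ a_n for every j ∈ [1, t]. -/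
open Filter Topology

/-- A list of at least `d` items contains a nonempty sublist of length at most `d` whose weight
is divisible by `d`. -/
theorem List.exists_sublist_dvd_sum {ι : Type*} (a : ι → ℕ) {d : ℕ} (hd : 0 < d) (l : List ι)
    (hl : d ≤ l.length) :
    ∃ u : List ι, u.Sublist l ∧ u ≠ [] ∧ u.length ≤ d ∧ d ∣ (u.map a).sum := by
  have : NeZero d := ⟨hd.ne'⟩
  obtain ⟨i, j, hij, he⟩ : ∃ i j : Fin (d + 1), i < j ∧
      (((l.take i).map a).sum : ZMod d) = (((l.take j).map a).sum : ZMod d) := by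
    obtain ⟨i, j, hne, he⟩ := Fintype.exists_ne_map_eq_of_card_lt
      (fun i : Fin (d + 1) => (((l.take i).map a).sum : ZMod d)) (by simp [ZMod.card])
    rcases lt_or_gt_of_ne hne with h | h
    · exact ⟨i, j, h, he⟩
    · exact ⟨j, i, h, he.symm⟩
  have hij' : (i : ℕ) < j := hij
  have hj := j.is_lt
  have hlen : ((l.take j).drop i).length = j - i := by
    rw [List.length_drop, List.length_take]; omega
  refine ⟨(l.take j).drop i, (List.drop_sublist _ _).trans (List.take_sublist _ _), ?_, ?_, ?_⟩
  · rw [← List.length_pos_iff_ne_nil]; omega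
  · omega
  · have hsplit : ((l.take j).map a).sum
        = ((l.take i).map a).sum + (((l.take j).drop i).map a).sum := by
      have h : (l.take j).take i = l.take i := by
        rw [List.take_take, min_eq_left hij'.le]
      rw [← List.sum_append, ← List.map_append, ← h, List.take_append_drop]
    rw [← ZMod.natCast_eq_zero_iff]
    rw [hsplit, Nat.cast_add] at he
    simpa using he

theorem Multiset.exists_le_dvd_sum {ι : Type*} (a : ι → ℕ) {d : ℕ} (hd : 0 < d) (s : Multiset ι)
    (hs : d ≤ s.card) :
    ∃ u ≤ s, u ≠ 0 ∧ u.card ≤ d ∧ d ∣ (u.map a).sum := by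
  induction s using Quotient.inductionOn with
  | h l =>
    obtain ⟨u, h1, h2, h3, h4⟩ := List.exists_sublist_dvd_sum a hd l (by simpa using hs)
    exact ⟨(u : Multiset ι), by simpa using h1.subperm, by simpa using h2, by simpa using h3,
      by simpa using h4⟩

theorem Multiset.sum_map_le_card_mul {ι : Type*} (a : ι → ℕ) {M : ℕ} (s : Multiset ι)
    (hM : ∀ i ∈ s, a i ≤ M) : (s.map a).sum ≤ s.card * M := by
  simpa using Multiset.sum_le_card_nsmul (s.map a) M (by simpa using hM)

/-- Submultisets of weight divisible by `d` approximate any target `T` from below up to an error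
less than `d * M`, unless they almost exhaust the whole multiset. -/
theorem Multiset.exists_le_dvd_sum_near {ι : Type*} (a : ι → ℕ) (ha : ∀ i, 0 < a i) {d M : ℕ}
    (hd : 0 < d) (hM0 : 0 < M) (z : Multiset ι) (hM : ∀ i ∈ z, a i ≤ M) (T : ℕ) :
    ∃ y ≤ z, d ∣ (y.map a).sum ∧ (y.map a).sum ≤ T ∧
      (T < (y.map a).sum + d * M ∨ (z.map a).sum < (y.map a).sum + d * M) := by
  classical
  let p : ℕ → Prop := fun S => ∃ y ≤ z, (y.map a).sum = S ∧ d ∣ S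
  have h0 : p 0 := ⟨0, by simp, by simp, by simp⟩
  obtain ⟨y, hy, hyS, hdvd⟩ := Nat.findGreatest_spec (P := p) (Nat.zero_le T) h0
  have hle := Nat.findGreatest_le (P := p) T
  rw [← hyS] at hdvd hle
  refine ⟨y, hy, hdvd, hle, ?_⟩
  by_contra! hcon
  obtain ⟨w, rfl⟩ := Multiset.le_iff_exists_add.mp hy
  have hw : d ≤ w.card := by
    by_contra! hlt
    have h1 := Multiset.sum_map_le_card_mul a w
      (fun i hi => hM i (Multiset.mem_add.mpr (Or.inr hi)))
    have h2 := hcon.2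
    rw [Multiset.map_add, Multiset.sum_add] at h2
    have : w.card * M < d * M := Nat.mul_lt_mul_of_pos_right hlt hM0
    omega
  obtain ⟨u, hu, hu0, hucard, hud⟩ := Multiset.exists_le_dvd_sum a hd w hw
  have hub := Multiset.sum_map_le_card_mul a u
    (fun i hi => hM i (Multiset.mem_add.mpr (Or.inr (Multiset.mem_of_le hu hi))))
  have hub' : u.card * M ≤ d * M := Nat.mul_le_mul_right _ hucard
  obtain ⟨i, hi⟩ := Multiset.exists_mem_of_ne_zero hu0
  have hpos : 0 < (u.map a).sum :=
    (ha i).trans_le (Multiset.single_le_sum (fun _ _ => Nat.zero_le _) _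
      (Multiset.mem_map_of_mem a hi))
  have hsum : ((y + u).map a).sum = (y.map a).sum + (u.map a).sum := by simp
  have := Nat.le_findGreatest (P := p) (m := ((y + u).map a).sum) (n := T) (by omega)
    ⟨y + u, by gcongr, rfl, hsum ▸ dvd_add hdvd hud⟩
  omega

/-- Enough items `q` of a common weight `d` allow one to hit a multiple `P` of `d` exactly. -/
theorem Multiset.exists_le_sum_eq_of_add {ι : Type*} (a : ι → ℕ) (ha : ∀ i, 0 < a i) {d M P : ℕ}
    (hd : 0 < d) (hM0 : 0 < M) (hdP : d ∣ P) (r q : Multiset ι) (hr : ∀ i ∈ r, a i ≤ M)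
    (hq : ∀ i ∈ q, a i = d) (hqM : M ≤ q.card + 1)
    (hsum : P + d * M ≤ ((r + q).map a).sum) : ∃ u ≤ r + q, (u.map a).sum = P := by
  have hconst : ∀ w : Multiset ι, w ≤ q → (w.map a).sum = w.card * d := fun w hw => by
    rw [Multiset.map_congr rfl (fun i hi => hq i (Multiset.mem_of_le hw hi))]; simp
  obtain ⟨y, hy, hyd, hyP, hor⟩ := Multiset.exists_le_dvd_sum_near a ha (d := d) hd hM0 r hr P
  obtain ⟨c, hc⟩ := (Nat.dvd_sub_iff_left hyP hyd).mpr hdP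
  have hc' : c ≤ q.card := by
    refine Nat.le_of_mul_le_mul_left (c := d) ?_ hd
    rcases hor with h | h
    · have hlt : d * c < d * M := by omega
      have := Nat.lt_of_mul_lt_mul_left hlt
      exact Nat.mul_le_mul_left _ (by omega)
    · rw [Multiset.map_add, Multiset.sum_add, hconst q le_rfl, mul_comm q.card] at hsum
      omega
  obtain ⟨w, hw, hwc⟩ : ∃ w ≤ q, w.card = c := by
    obtain ⟨w, hw⟩ := Multiset.card_pos_iff_exists_mem.mp
      (by rw [Multiset.card_powersetCard]; exact Nat.choose_pos hc' :
        0 < (q.powersetCard c).card)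
    exact ⟨w, Multiset.mem_powersetCard.mp hw⟩
  refine ⟨y + w, add_le_add hy hw, ?_⟩
  rw [Multiset.map_add, Multiset.sum_add, hconst w hw, hwc, mul_comm]
  omega

theorem Multiset.sum_map_eq_sum_count {ι : Type*} [Fintype ι] [DecidableEq ι] (a : ι → ℕ)
    (s : Multiset ι) : (s.map a).sum = ∑ i, a i * s.count i := by
  induction s using Multiset.induction with
  | empty => simp
  | cons i s ih =>
    simp [ih, Multiset.count_cons, mul_add, Finset.sum_add_distrib, add_comm]

theorem Finset.sum_le_prod_of_two_le {ι : Type*} (a : ι → ℕ) (T : Finset ι) (hT : T.Nonempty)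
    (h2 : ∀ i ∈ T, 2 ≤ a i) : ∑ i ∈ T, a i ≤ ∏ i ∈ T, a i := by
  classical
  induction hT using Finset.Nonempty.cons_induction with
  | singleton i => simp
  | cons i T hi hT ih =>
    rw [Finset.sum_cons, Finset.prod_cons]
    have h1 := ih (fun j hj => h2 j (Finset.mem_cons_of_mem hj))
    have h3 := h2 i (Finset.mem_cons_self _ _)
    obtain ⟨j, hj⟩ := hT
    have h4 := h2 j (Finset.mem_cons_of_mem hj)
    have h5 : a j ≤ ∑ i ∈ T, a i := Finset.single_le_sum (fun _ _ => Nat.zero_le _) hj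
    nlinarith

theorem Finset.mul_le_prod_of_ne {ι : Type*} (a : ι → ℕ) (ha : ∀ i, 0 < a i) (T : Finset ι)
    {i j : ι} (hi : i ∈ T) (hj : j ∈ T) (hij : i ≠ j) : a i * a j ≤ ∏ k ∈ T, a k := by
  classical
  rw [← Finset.prod_pair hij]
  exact Finset.prod_le_prod_of_subset_of_one_le' (by grind) (fun k _ _ => ha k)

/-- A multiset of items of total weight at least twice the product of all weights contains a
submultiset whose weight is exactly that product. -/
theorem Multiset.exists_le_sum_eq_prod {ι : Type*} [Fintype ι] [DecidableEq ι] (a : ι → ℕ) (ha : ∀ i, 0 < a i)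
    (s : Multiset ι) (hs : 2 * ∏ i, a i ≤ (s.map a).sum) :
    ∃ u ≤ s, (u.map a).sum = ∏ i, a i := by
  set P := ∏ i, a i with hP
  have hPpos : 0 < P := Finset.prod_pos fun i _ => ha i
  have hleP : ∀ i, a i ≤ P := fun i =>
    Finset.single_le_prod' (f := a) (fun k _ => ha k) (Finset.mem_univ i)
  -- it suffices to have enough items of one weight, relative to the other weights
  have key : ∀ (p : ι → Prop) [DecidablePred p] (d M : ℕ), 0 < d → 0 < M → d ∣ P → d * M ≤ P →
      (∀ i, ¬ p i → a i ≤ M) → (∀ i, p i → a i = d) →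
      M ≤ (s.filter p).card + 1 → ∃ u ≤ s, (u.map a).sum = P := by
    intro p _ d M hd hM hdP hdM hr hq hc
    have hsplit : s.filter (fun i => ¬ p i) + s.filter p = s := by
      rw [add_comm, Multiset.filter_add_not]
    have := Multiset.exists_le_sum_eq_of_add a ha hd hM hdP (s.filter fun i => ¬ p i)
      (s.filter p) (fun i hi => hr i (Multiset.mem_filter.mp hi).2)
      (fun i hi => hq i (Multiset.mem_filter.mp hi).2) hc (by rw [hsplit]; omega)
    rwa [hsplit] at this
  by_contra hno
  have key' : ∀ k M, 0 < M → a k * M ≤ P → (∀ i, i ≠ k → a i ≤ M) → s.count k + 2 ≤ M := by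
    intro k M hM h1 h2
    by_contra! h3
    refine hno (key (fun i => i = k) (a k) M (ha k) hM (Finset.dvd_prod_of_mem a (by simp)) h1
      h2 (fun i hi => by rw [hi]) ?_)
    rw [Multiset.filter_eq', Multiset.card_replicate]
    omega
  set J : Finset ι := Finset.univ.filter fun i => a i ≠ 1 with hJ
  have hJ2 : ∀ i ∈ J, 2 ≤ a i := fun i hi => by
    have := ha i
    have := (Finset.mem_filter.mp hi).2
    omega
  have hPJ : P = ∏ i ∈ J, a i := (Finset.prod_filter_ne_one _).symm
  set O := s.filter fun i => a i = 1 with hO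
  have hones : (s.map a).sum = O.card + ∑ i ∈ J, a i * s.count i := by
    have h1 : (O.map a).sum = O.card := by
      rw [Multiset.map_congr rfl (fun i hi => (Multiset.mem_filter.mp hi).2)]; simp [hO]
    have h2 : ((s.filter fun i => a i ≠ 1).map a).sum = ∑ i ∈ J, a i * s.count i := by
      rw [Multiset.sum_map_eq_sum_count, hJ, Finset.sum_filter]
      refine Finset.sum_congr rfl fun i _ => ?_
      rw [Multiset.count_filter]
      split_ifs <;> simp
    rw [← h1, ← h2, ← Multiset.sum_add, ← Multiset.map_add, hO, Multiset.filter_add_not]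
  have keyO : ∀ M, 0 < M → M ≤ P → (∀ i ∈ J, a i ≤ M) → O.card + 2 ≤ M := by
    intro M hM h1 h2
    by_contra! h3
    exact hno (key (fun i => a i = 1) 1 M one_pos hM (one_dvd _) (by omega)
      (fun i hi => h2 i (by simp [hJ, hi])) (fun i hi => hi) (by rw [← hO]; omega))
  obtain hJe | hJne := J.eq_empty_or_nonempty
  · have := keyO 1 one_pos hPpos (by simp [hJe])
    omega
  obtain ⟨m, hm, hmax⟩ := J.exists_max_image a hJne
  have hle : ∀ i, a i ≤ a m := fun i => by
    by_cases hi : i ∈ J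
    · exact hmax i hi
    · have := ha m
      have : a i = 1 := by simpa [hJ] using hi
      omega
  have hOm := keyO (a m) (ha m) (hleP m) hmax
  rw [hones, ← Finset.add_sum_erase J _ hm] at hs
  have hPm : P = a m * ∏ i ∈ J.erase m, a i := by rw [hPJ, Finset.mul_prod_erase J a hm]
  have hk : ∀ k ∈ J.erase m, s.count k ≤ a m := fun k hk => by
    have := key' k (a m) (ha m)
      (Finset.mul_le_prod_of_ne a ha _ (by simp) (by simp) (Finset.ne_of_mem_erase hk))
      (fun i _ => hle i)
    omega
  obtain hTe | hTne := (J.erase m).eq_empty_or_nonempty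
  · rw [hTe] at hPm hs
    have := key' m 1 one_pos (by simp [hPm]) (fun i hi => by
      have : i ∉ J := fun h => by
        have : i ∈ J.erase m := Finset.mem_erase.mpr ⟨hi, h⟩
        simp [hTe] at this
      have : a i = 1 := by simpa [hJ] using this
      omega)
    omega
  obtain ⟨p, hp, hpmax⟩ := (J.erase m).exists_max_image a hTne
  have hm' := key' m (a p) (ha p)
    (Finset.mul_le_prod_of_ne a ha _ (by simp) (by simp) (Finset.ne_of_mem_erase hp).symm)
    (fun i hi => by
      by_cases h : i ∈ J
      · exact hpmax i (Finset.mem_erase.mpr ⟨hi, h⟩)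
      · have := ha p
        have : a i = 1 := by simpa [hJ] using h
        omega)
  have hT2 : ∀ i ∈ J.erase m, 2 ≤ a i := fun i hi => hJ2 i (Finset.mem_of_mem_erase hi)
  have h1 := Finset.sum_le_prod_of_two_le a _ hTne hT2
  have h2 : a p ≤ ∏ i ∈ J.erase m, a i :=
    Finset.single_le_prod' (f := a) (fun k _ => ha k) hp
  have h3 : ∑ i ∈ J.erase m, a i * s.count i ≤ a m * ∑ i ∈ J.erase m, a i := by
    rw [Finset.mul_sum]
    exact Finset.sum_le_sum fun i hi => by
      rw [mul_comm]; exact Nat.mul_le_mul_right _ (hk i hi)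
  nlinarith [ha m, Nat.mul_le_mul_left (a m) h1, Nat.mul_le_mul_left (a m) h2,
    Nat.mul_le_mul_left (a m) hm']

/-- A multiset whose weight is `t` times the product of all weights splits into `t` parts, each
having that product as its weight. -/
theorem Multiset.exists_sum_eq_of_sum_eq_mul_prod {ι : Type*} [Fintype ι] [DecidableEq ι] (a : ι → ℕ)
    (ha : ∀ i, 0 < a i) (t : ℕ) (s : Multiset ι) (hs : (s.map a).sum = t * ∏ i, a i) :
    ∃ y : Fin t → Multiset ι, ∑ j, y j = s ∧ ∀ j, ((y j).map a).sum = ∏ i, a i := by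
  induction t generalizing s with
  | zero =>
    refine ⟨Fin.elim0, ?_, fun j => j.elim0⟩
    have : s = 0 := by
      refine Multiset.eq_zero_of_forall_notMem fun i hi => ?_
      have := Multiset.single_le_sum (fun _ _ => Nat.zero_le _) _ (Multiset.mem_map_of_mem a hi)
      have := ha i
      omega
    simp [this]
  | succ t ih =>
    obtain ⟨u, hu, hua⟩ : ∃ u ≤ s, (u.map a).sum = ∏ i, a i := by
      rcases Nat.eq_zero_or_pos t with rfl | ht
      · exact ⟨s, le_rfl, by simpa using hs⟩
      · refine Multiset.exists_le_sum_eq_prod a ha s ?_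
        rw [hs]
        exact Nat.mul_le_mul_right _ (by omega)
    obtain ⟨w, rfl⟩ := Multiset.le_iff_exists_add.mp hu
    rw [Multiset.map_add, Multiset.sum_add, hua, add_mul, one_mul, add_comm] at hs
    obtain ⟨y, hy, hya⟩ := ih w (Nat.add_right_cancel hs)
    refine ⟨Fin.cons u y, by simp [Fin.sum_univ_succ, hy], fun j => ?_⟩
    cases j using Fin.cases with
    | zero => simpa using hua
    | succ j => simpa using hya j

/-- If `a₁x₁ + ⋯ + aₙxₙ = t·a₁⋯aₙ` with `aᵢ ≥ 1`, `xᵢ ≥ 0` and `t ≥ 1`,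
then there are `xᵢ⁽ʲ⁾ ∈ [0, xᵢ]` (for `i ∈ [1,n]`, `j ∈ [1,t]`) with
`∑_j xᵢ⁽ʲ⁾ = xᵢ` for all `i` and `∑_i aᵢxᵢ⁽ʲ⁾ = a₁⋯aₙ` for all `j`. -/
theorem statement6 (n : ℕ) (hn : 0 < n) (a x : Fin n → ℕ) (ha : ∀ i, 0 < a i)
    (t : ℕ) (ht : 1 ≤ t) (h : ∑ i, a i * x i = t * ∏ i, a i) :
    ∃ y : Fin n → Fin t → ℕ, (∀ i j, y i j ≤ x i) ∧
      (∀ i, ∑ j, y i j = x i) ∧ ∀ j, ∑ i, a i * y i j = ∏ i, a i := by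
  set s : Multiset (Fin n) := ∑ i, Multiset.replicate (x i) i with hs
  have hcount : ∀ i, s.count i = x i := fun i => by
    simp [hs, Multiset.count_sum', Multiset.count_replicate]
  obtain ⟨y, hy, hya⟩ := Multiset.exists_sum_eq_of_sum_eq_mul_prod a ha t s
    (by simp only [Multiset.sum_map_eq_sum_count, hcount, h])
  have hsum : ∀ i, ∑ j, (y j).count i = x i := fun i => by
    rw [← hcount, ← hy, Multiset.count_sum']
  refine ⟨fun i j => (y j).count i, fun i j => ?_, hsum, fun j => ?_⟩
  · rw [← hsum i]
    exact Finset.single_le_sum (f := fun j => (y j).count i) (fun _ _ => Nat.zero_le _)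
      (Finset.mem_univ j)
  · rw [← hya j, Multiset.sum_map_eq_sum_count]
end
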